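/- arXiv:2102.05003 — 2 statements merged into one kernel-verified Lean document; each statement's English description precedes it below -/
import Mathlib

section
/- Let X_1, …, X_n be positive integrable random variables with sum S := X_1 + ⋯ + X_n, and assume ℙ(S > VaR_q(S)) > 0 for every q ∈ [0,1). Then the following are equivalent: (i) r_{q,i} = r̃_{q,i} for all q ∈ [0,1) and all i ∈ {1,…,n}; (ii) for all i ≠ j in {1,…,n} and all real t > 0, 𝔼[X_i·e^{−tS}]/𝔼[X_i] = 𝔼[X_j·e^{−tS}]/𝔼[X_j] (equivalently, the partially size-biased sums S^{(∗)_i} and S^{(∗)_j} are equal in distribution). Moreover, when these hold, r_{q,i} = r̃_{q,i} = 𝔼[X_i]/𝔼[S] for all q ∈ [0,1) and all i. -/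
open MeasureTheory Set

/-- Value-at-Risk at level `q`: `inf {s ∈ [0,∞) : ℙ(S ≤ s) ≥ q}`. -/
noncomputable def VaR {Ω : Type*} [MeasurableSpace Ω] (μ : Measure Ω) (S : Ω → ℝ) (q : ℝ) : ℝ :=
  sInf {s : ℝ | 0 ≤ s ∧ ENNReal.ofReal q ≤ μ {ω | S ω ≤ s}}

/-- The tail event `{S > VaR_q(S)}`. -/
def tailSet {Ω : Type*} [MeasurableSpace Ω] (μ : Measure Ω) (S : Ω → ℝ) (q : ℝ) : Set Ω :=
  {ω | VaR μ S q < S ω}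

/-- CTE-based proportional allocation `r_{q,i} = 𝔼[X·1{S>s_q}]/𝔼[S·1{S>s_q}]`. -/
noncomputable def cteAlloc {Ω : Type*} [MeasurableSpace Ω] (μ : Measure Ω)
    (X S : Ω → ℝ) (q : ℝ) : ℝ :=
  (∫ ω in tailSet μ S q, X ω ∂μ) / (∫ ω in tailSet μ S q, S ω ∂μ)

/-- GTE-based proportional allocation `r̃_{q,i} = 𝔼[(X/S)·1{S>s_q}]/ℙ(S>s_q)`. -/
noncomputable def gteAlloc {Ω : Type*} [MeasurableSpace Ω] (μ : Measure Ω)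
    (X S : Ω → ℝ) (q : ℝ) : ℝ :=
  (∫ ω in tailSet μ S q, X ω / S ω ∂μ) / (μ (tailSet μ S q)).toReal

open Filter Topology

noncomputable def nu {Ω : Type*} [MeasurableSpace Ω] (μ : Measure Ω) (f S : Ω → ℝ) : Measure ℝ :=
  (μ.withDensity (fun ω => ENNReal.ofReal (f ω))).map S

lemma int_nu {Ω : Type*} [MeasurableSpace Ω] (μ : Measure Ω) {f S : Ω → ℝ}
    (hf : Measurable f) (hf0 : ∀ ω, 0 ≤ f ω) (hS : Measurable S) {g : ℝ → ℝ} (hg : Measurable g) :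
    ∫ x, g x ∂(nu μ f S) = ∫ ω, f ω * g (S ω) ∂μ := by
  unfold nu
  rw [integral_map hS.aemeasurable hg.aestronglyMeasurable,
    integral_withDensity_eq_integral_toReal_smul hf.ennreal_ofReal (by simp)]
  simp [ENNReal.toReal_ofReal, hf0]

lemma fin_nu {Ω : Type*} [MeasurableSpace Ω] (μ : Measure Ω) {f S : Ω → ℝ}
    (hfi : Integrable f μ) : IsFiniteMeasure (nu μ f S) := by
  have := isFiniteMeasure_withDensity_ofReal hfi.2
  unfold nu
  infer_instance

lemma ext_tail {Ω : Type*} [MeasurableSpace Ω] (μ : Measure Ω) {f g S : Ω → ℝ}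
    (hf : Measurable f) (hf0 : ∀ ω, 0 ≤ f ω) (hfi : Integrable f μ)
    (hg : Measurable g) (hg0 : ∀ ω, 0 ≤ g ω) (hgi : Integrable g μ)
    (hS : Measurable S) (hS0 : ∀ ω, 0 < S ω)
    (h : ∀ u : ℝ, 0 ≤ u → ∫ ω in {ω | u < S ω}, f ω ∂μ = ∫ ω in {ω | u < S ω}, g ω ∂μ) :
    nu μ f S = nu μ g S := by
  have := fin_nu μ (S := S) hfi
  have key : ∀ {f : Ω → ℝ}, Measurable f → (∀ ω, 0 ≤ f ω) → Integrable f μ → ∀ u : ℝ,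
      nu μ f S (Ioi u) = ENNReal.ofReal (∫ ω in {ω | max u 0 < S ω}, f ω ∂μ) := by
    intro f hf hf0 hfi u
    unfold nu
    rw [Measure.map_apply hS measurableSet_Ioi, withDensity_apply _ (hS measurableSet_Ioi),
      ofReal_integral_eq_lintegral_ofReal hfi.integrableOn (ae_of_all _ hf0)]
    congr 2
    ext ω
    simp [hS0]
  have key2 : ∀ u : ℝ, nu μ f S (Ioi u) = nu μ g S (Ioi u) := by
    intro u
    rw [key hf hf0 hfi, key hg hg0 hgi, h _ (le_max_right _ _)]
  have hu : ∀ {f : Ω → ℝ}, nu μ f S univ = nu μ f S (Ioi 0) := by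
    intro f
    unfold nu
    rw [Measure.map_apply hS measurableSet_Ioi, Measure.map_apply hS MeasurableSet.univ]
    congr 1
    ext ω
    simp [hS0]
  refine ext_of_generate_finite (range Ioi) (borel_eq_generateFrom_Ioi ℝ ▸ BorelSpace.measurable_eq)
    isPiSystem_Ioi ?_ ?_
  · rintro _ ⟨u, rfl⟩
    exact key2 u
  · rw [hu, hu, key2]

lemma ext_unit {Ω : Type*} [MeasurableSpace Ω] (μ : Measure Ω) {f g U : Ω → ℝ}
    (hf : Measurable f) (hf0 : ∀ ω, 0 ≤ f ω) (hfi : Integrable f μ)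
    (hg : Measurable g) (hg0 : ∀ ω, 0 ≤ g ω) (hgi : Integrable g μ)
    (hU : Measurable U) (hU0 : ∀ ω, U ω ∈ Icc (0:ℝ) 1)
    (h : ∀ k : ℕ, ∫ ω, f ω * U ω ^ k ∂μ = ∫ ω, g ω * U ω ^ k ∂μ) :
    nu μ f U = nu μ g U := by
  have := fin_nu μ (S := U) hfi
  have := fin_nu μ (S := U) hgi
  have bint : ∀ {f : Ω → ℝ}, Integrable f μ → ∀ {φ : ℝ → ℝ}, Continuous φ →
      Integrable (fun ω => f ω * φ (U ω)) μ := by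
    intro f hfi φ hφ
    obtain ⟨C, hC⟩ := isCompact_Icc.exists_bound_of_continuousOn (hφ.continuousOn (s := Icc (0:ℝ) 1))
    exact hfi.mul_bdd (c := C) (hφ.measurable.comp hU).aestronglyMeasurable
      (ae_of_all _ fun ω => hC _ (hU0 ω))
  have hpoly : ∀ p : Polynomial ℝ,
      ∫ ω, f ω * p.eval (U ω) ∂μ = ∫ ω, g ω * p.eval (U ω) ∂μ := by
    intro p
    simp only [Polynomial.eval_eq_sum_range, Finset.mul_sum]
    rw [integral_finsetSum, integral_finsetSum]
    · refine Finset.sum_congr rfl fun k _ => ?_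
      have : ∀ f : Ω → ℝ, ∫ ω, f ω * (p.coeff k * U ω ^ k) ∂μ
          = p.coeff k * ∫ ω, f ω * U ω ^ k ∂μ := by
        intro f
        rw [← integral_const_mul]
        congr 1
        ext ω
        ring
      rw [this, this, h]
    · intro k _
      exact bint hgi (φ := fun x => p.coeff k * x ^ k) (by fun_prop)
    · intro k _
      exact bint hfi (φ := fun x => p.coeff k * x ^ k) (by fun_prop)
  have close : ∀ {f : Ω → ℝ}, (∀ ω, 0 ≤ f ω) → Integrable f μ → ∀ {φ ψ : ℝ → ℝ}, Continuous φ →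
      Continuous ψ → ∀ ε : ℝ, (∀ x ∈ Icc (0:ℝ) 1, |ψ x - φ x| < ε) →
      |∫ ω, f ω * φ (U ω) ∂μ - ∫ ω, f ω * ψ (U ω) ∂μ| ≤ ε * ∫ ω, f ω ∂μ := by
    intro f hf0 hfi φ ψ hφ hψ ε hε
    rw [← integral_sub (bint hfi hφ) (bint hfi hψ), ← integral_const_mul, ← Real.norm_eq_abs]
    refine norm_integral_le_of_norm_le (hfi.const_mul ε) (ae_of_all _ fun ω => ?_)
    rw [← mul_sub, norm_mul, Real.norm_of_nonneg (hf0 ω), mul_comm, Real.norm_eq_abs, abs_sub_comm]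
    exact mul_le_mul_of_nonneg_right (hε _ (hU0 ω)).le (hf0 ω)
  refine ext_of_forall_integral_eq_of_IsFiniteMeasure fun φ => ?_
  rw [int_nu μ hf hf0 hU φ.continuous.measurable, int_nu μ hg hg0 hU φ.continuous.measurable]
  rw [← sub_eq_zero, ← abs_nonpos_iff]
  have hI : 0 ≤ ∫ ω, f ω ∂μ + ∫ ω, g ω ∂μ := add_nonneg (integral_nonneg hf0) (integral_nonneg hg0)
  refine le_of_forall_pos_le_add fun δ hδ => ?_
  set I := ∫ ω, f ω ∂μ + ∫ ω, g ω ∂μ with hIdef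
  obtain ⟨p, hp⟩ := exists_polynomial_near_of_continuousOn 0 1 φ φ.continuous.continuousOn
    (δ / (I + 1)) (by positivity)
  have h1 := close hf0 hfi φ.continuous p.continuous _ hp
  have h2 := close hg0 hgi φ.continuous p.continuous _ hp
  rw [hpoly p] at h1
  have h3 : δ / (I + 1) * I ≤ δ := by
    rw [div_mul_eq_mul_div, div_le_iff₀ (by positivity)]
    nlinarith
  have h4 : δ / (I + 1) * I = δ / (I + 1) * ∫ ω, f ω ∂μ + δ / (I + 1) * ∫ ω, g ω ∂μ := by
    rw [hIdef, mul_add]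
  rw [abs_le] at *
  constructor <;> linarith [h1.1, h1.2, h2.1, h2.2]

lemma ext_laplace {Ω : Type*} [MeasurableSpace Ω] (μ : Measure Ω) {f g S : Ω → ℝ}
    (hf : Measurable f) (hf0 : ∀ ω, 0 ≤ f ω) (hfi : Integrable f μ)
    (hg : Measurable g) (hg0 : ∀ ω, 0 ≤ g ω) (hgi : Integrable g μ)
    (hS : Measurable S) (hS0 : ∀ ω, 0 < S ω)
    (h0 : ∫ ω, f ω ∂μ = ∫ ω, g ω ∂μ)
    (h : ∀ t : ℝ, 0 < t →
      ∫ ω, f ω * Real.exp (-t * S ω) ∂μ = ∫ ω, g ω * Real.exp (-t * S ω) ∂μ) :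
    nu μ f S = nu μ g S := by
  have hU : Measurable fun ω => Real.exp (- S ω) := by fun_prop
  have e := ext_unit μ hf hf0 hfi hg hg0 hgi hU
    (fun ω => ⟨(Real.exp_pos _).le, Real.exp_le_one_iff.2 (by linarith [hS0 ω])⟩) (by
      intro k
      rcases Nat.eq_zero_or_pos k with rfl | hk
      · simpa using h0
      · have := h k (by exact_mod_cast hk)
        simpa [← Real.exp_nat_mul] using this)
  have back : ∀ f : Ω → ℝ, nu μ f S = (nu μ f fun ω => Real.exp (- S ω)).map
      (fun x => - Real.log x) := by
    intro f
    unfold nu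
    rw [Measure.map_map (by fun_prop) hU]
    congr 1
    ext ω
    simp
  rw [back f, back g, e]

lemma deriv_K {Ω : Type*} [MeasurableSpace Ω] (μ : Measure Ω) [IsProbabilityMeasure μ]
    {R S : Ω → ℝ} (hR : Measurable R) (hR1 : ∀ ω, |R ω| ≤ 1) (hS : Measurable S)
    (hSi : Integrable S μ) (u : ℝ) :
    HasDerivWithinAt (fun u => ∫ ω, R ω * max (S ω - u) 0 ∂μ)
      (-∫ ω in {ω | u < S ω}, R ω ∂μ) (Ici u) u := by
  rw [← hasDerivWithinAt_Ioi_iff_Ici, hasDerivWithinAt_iff_tendsto_slope' self_notMem_Ioi]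
  have hi : ∀ v, Integrable (fun ω => R ω * max (S ω - v) 0) μ := by
    intro v
    exact ((hSi.sub (integrable_const v)).pos_part).bdd_mul (c := 1) hR.aestronglyMeasurable
      (ae_of_all _ hR1)
  have e1 : (-∫ ω in {ω | u < S ω}, R ω ∂μ)
      = ∫ ω, -({ω | u < S ω}.indicator R ω) ∂μ := by
    rw [integral_neg, integral_indicator (measurableSet_lt measurable_const hS)]
  have e2 : slope (fun u => ∫ ω, R ω * max (S ω - u) 0 ∂μ) u
      = fun v => ∫ ω, (R ω * max (S ω - v) 0 - R ω * max (S ω - u) 0) / (v - u) ∂μ := by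
    ext v
    rw [slope_def_field, ← integral_sub (hi v) (hi u), integral_div]
  rw [e1, e2]
  refine tendsto_integral_filter_of_dominated_convergence (fun _ => 1) ?_ ?_ (integrable_const _) ?_
  · exact Eventually.of_forall fun v => (((hi v).sub (hi u)).div_const _).aestronglyMeasurable
  · filter_upwards [self_mem_nhdsWithin] with v hv
    refine ae_of_all _ fun ω => ?_
    have hv' : 0 < v - u := sub_pos.2 hv
    rw [← mul_sub, norm_div, norm_mul, Real.norm_of_nonneg hv'.le, div_le_one hv']
    have h1 : ‖max (S ω - v) 0 - max (S ω - u) 0‖ ≤ v - u := by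
      rw [Real.norm_eq_abs]
      refine (abs_max_sub_max_le_abs _ _ _).trans ?_
      rw [show S ω - v - (S ω - u) = -(v - u) by ring, abs_neg, abs_of_pos hv']
    calc ‖R ω‖ * _ ≤ 1 * (v - u) := mul_le_mul (hR1 ω) h1 (norm_nonneg _) zero_le_one
      _ = _ := one_mul _
  · refine ae_of_all _ fun ω => ?_
    refine tendsto_nhds_of_eventually_eq ?_
    by_cases hω : u < S ω
    · filter_upwards [self_mem_nhdsWithin, nhdsWithin_le_nhds (Iio_mem_nhds hω)] with v hv hv2
      have hv' : 0 < v - u := sub_pos.2 hv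
      have hv2' : v < S ω := hv2
      rw [max_eq_left (by linarith), max_eq_left (by linarith), indicator_of_mem (by exact hω)]
      field_simp
      ring
    · filter_upwards [self_mem_nhdsWithin] with v hv
      have hv' : u < v := hv
      rw [max_eq_right (by linarith), max_eq_right (by linarith), indicator_of_notMem (by exact hω)]
      simp

lemma cont_K {Ω : Type*} [MeasurableSpace Ω] (μ : Measure Ω) [IsProbabilityMeasure μ]
    {R S : Ω → ℝ} (hR : Measurable R) (hR1 : ∀ ω, |R ω| ≤ 1) (hS : Measurable S)
    (hSi : Integrable S μ) (b : ℝ) :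
    ContinuousOn (fun u => ∫ ω, R ω * max (S ω - u) 0 ∂μ) (Icc 0 b) := by
  refine continuousOn_of_dominated (bound := fun ω => |S ω|) ?_ ?_ hSi.abs ?_
  · intro u _
    exact Measurable.aestronglyMeasurable (by fun_prop)
  · intro u hu
    refine ae_of_all _ fun ω => ?_
    rw [norm_mul]
    have h1 : ‖max (S ω - u) 0‖ ≤ |S ω| := by
      rw [Real.norm_of_nonneg (le_max_right _ _)]
      exact max_le (by linarith [le_abs_self (S ω), hu.1]) (abs_nonneg _)
    calc ‖R ω‖ * _ ≤ 1 * |S ω| := mul_le_mul (hR1 ω) h1 (norm_nonneg _) zero_le_one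
      _ = _ := one_mul _
  · exact ae_of_all _ fun ω => by fun_prop

lemma K_eq {Ω : Type*} [MeasurableSpace Ω] (μ : Measure Ω) [IsProbabilityMeasure μ]
    {R S : Ω → ℝ} (hR : Measurable R) (hR1 : ∀ ω, |R ω| ≤ 1) (hS : Measurable S)
    (hSi : Integrable S μ) (u : ℝ) :
    ∫ ω, R ω * max (S ω - u) 0 ∂μ =
      ∫ ω in {ω | u < S ω}, R ω * S ω ∂μ - u * ∫ ω in {ω | u < S ω}, R ω ∂μ := by
  have hm : MeasurableSet {ω | u < S ω} := measurableSet_lt measurable_const hS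
  have i1 : Integrable (fun ω => R ω * S ω) μ :=
    hSi.bdd_mul (c := 1) hR.aestronglyMeasurable (ae_of_all _ hR1)
  have i2 : Integrable R μ :=
    (integrable_const (1:ℝ)).mono' hR.aestronglyMeasurable (ae_of_all _ hR1)
  rw [← integral_const_mul, ← integral_sub i1.integrableOn (i2.const_mul u).integrableOn,
    ← integral_indicator hm]
  congr 1
  ext ω
  by_cases hω : u < S ω
  · rw [max_eq_left (by linarith), indicator_of_mem (by exact hω)]
    ring
  · rw [max_eq_right (by linarith), indicator_of_notMem (by exact hω), mul_zero]

lemma set_pos {Ω : Type*} [MeasurableSpace Ω] (μ : Measure Ω) {f : Ω → ℝ} {s : Set Ω}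
    (hm : MeasurableSet s) (hs : 0 < μ s)
    (hf : Integrable f μ) (h0 : ∀ ω ∈ s, 0 < f ω) : 0 < ∫ ω in s, f ω ∂μ := by
  rw [setIntegral_pos_iff_support_of_nonneg_ae
    ((ae_restrict_iff' hm).2 (ae_of_all _ fun ω h => (h0 ω h).le)) hf.integrableOn]
  have hsub : s ⊆ Function.support f := fun ω h => (h0 ω h).ne'
  rwa [inter_eq_self_of_subset_right hsub]

lemma core {Ω : Type*} [MeasurableSpace Ω] (μ : Measure Ω) [IsProbabilityMeasure μ]
    {R S : Ω → ℝ} (hR : Measurable R) (hR1 : ∀ ω, |R ω| ≤ 1) (hS : Measurable S)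
    (hSi : Integrable S μ) (hS0 : ∀ ω, 0 < S ω)
    (h : ∀ u : ℝ, 0 ≤ u → 0 < μ {ω | u < S ω} →
      (∫ ω in {ω | u < S ω}, R ω * S ω ∂μ) / (∫ ω in {ω | u < S ω}, S ω ∂μ) =
      (∫ ω in {ω | u < S ω}, R ω ∂μ) / (μ {ω | u < S ω}).toReal)
    (b : ℝ) (hb : 0 ≤ b) (hb1 : 0 < μ {ω | b < S ω}) :
      (∫ ω in {ω | b < S ω}, R ω * S ω ∂μ) / (∫ ω in {ω | b < S ω}, S ω ∂μ) =
        (∫ ω, R ω * S ω ∂μ) / ∫ ω, S ω ∂μ := by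
  have hm : ∀ u, MeasurableSet {ω | u < S ω} := fun u => measurableSet_lt measurable_const hS
  have one1 : ∀ ω : Ω, |(fun _ => (1:ℝ)) ω| ≤ 1 := by simp
  set K := fun u => ∫ ω, R ω * max (S ω - u) 0 ∂μ with hK
  set L := fun u => ∫ ω, (1:ℝ) * max (S ω - u) 0 ∂μ with hL
  set H := fun u => ∫ ω in {ω | u < S ω}, R ω ∂μ with hH
  set G := fun u => (μ {ω | u < S ω}).toReal with hG
  have hposu : ∀ u ∈ Icc 0 b, 0 < μ {ω | u < S ω} := fun u hu =>
    hb1.trans_le (measure_mono fun ω (hω : b < S ω) => hu.2.trans_lt hω)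
  have Geq : ∀ u, ∫ ω in {ω | u < S ω}, (1:ℝ) ∂μ = G u := by
    intro u
    simp [hG, Measure.real]
  have dK : ∀ u, HasDerivWithinAt K (- H u) (Ici u) u := fun u => deriv_K μ hR hR1 hS hSi u
  have dL : ∀ u, HasDerivWithinAt L (- G u) (Ici u) u := fun u => by
    have := deriv_K μ (R := fun _ => 1) measurable_const one1 hS hSi u
    rwa [Geq] at this
  have Kf : ∀ u, K u = ∫ ω in {ω | u < S ω}, R ω * S ω ∂μ - u * H u := fun u =>
    K_eq μ hR hR1 hS hSi u
  have Lf : ∀ u, L u = ∫ ω in {ω | u < S ω}, S ω ∂μ - u * G u := fun u => by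
    have := K_eq μ (R := fun _ => 1) measurable_const one1 hS hSi u
    simp only [Geq, one_mul] at this
    simp only [hL, one_mul]
    exact this
  have Gpos : ∀ u ∈ Icc 0 b, 0 < G u := fun u hu =>
    ENNReal.toReal_pos (hposu u hu).ne' (measure_ne_top _ _)
  have Mpos : ∀ u ∈ Icc 0 b, 0 < ∫ ω in {ω | u < S ω}, S ω ∂μ := fun u hu =>
    set_pos μ (hm u) (hposu u hu) hSi fun ω _ => hS0 ω
  have Lpos : ∀ u ∈ Icc 0 b, 0 < L u := fun u hu => by
    have := set_pos μ (f := fun ω => S ω - u) (hm u) (hposu u hu)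
      (hSi.sub (integrable_const u)) fun ω hω => sub_pos.2 hω
    rw [integral_sub hSi.integrableOn (integrable_const u).integrableOn] at this
    rw [Lf, ← Geq, ← integral_const_mul]
    simpa using this
  have hdet : ∀ u ∈ Icc 0 b, K u * G u = H u * L u := by
    intro u hu
    have := h u hu.1 (hposu u hu)
    rw [div_eq_div_iff (Mpos u hu).ne' (Gpos u hu).ne'] at this
    rw [Kf, Lf]
    simp only [hG, hH]
    linear_combination this
  have const := constant_of_has_deriv_right_zero (f := fun u => K u / L u) (a := 0) (b := b)
    ((cont_K μ hR hR1 hS hSi b).div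
      (cont_K μ (R := fun _ => 1) measurable_const one1 hS hSi b) fun u hu => (Lpos u hu).ne')
    (by
      intro u hu
      have hu' := Ico_subset_Icc_self hu
      have e : (-H u * L u - K u * -G u) / L u ^ 2 = 0 := by
        rw [div_eq_zero_iff]
        left
        linear_combination hdet u hu'
      have d := (dK u).div (dL u) (Lpos u hu').ne'
      rw [e] at d
      exact d)
    b (right_mem_Icc.2 hb)
  have hb' : b ∈ Icc 0 b := right_mem_Icc.2 hb
  have huniv : {ω | 0 < S ω} = univ := by ext; simp [hS0]
  have const' : K b / L b = K 0 / L 0 := const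
  rw [Kf 0, Lf 0, huniv] at const'
  simp only [Measure.restrict_univ, zero_mul, sub_zero] at const'
  rw [← const', h b hb hb1, div_eq_div_iff (Gpos b hb').ne' (Lpos b hb').ne']
  exact (hdet b hb').symm

lemma VaR_nonneg {Ω : Type*} [MeasurableSpace Ω] (μ : Measure Ω) (S : Ω → ℝ) (q : ℝ) :
    0 ≤ VaR μ S q := Real.sInf_nonneg fun _ h => h.1

lemma exists_q {Ω : Type*} [MeasurableSpace Ω] (μ : Measure Ω) [IsProbabilityMeasure μ]
    {S : Ω → ℝ} (hS : Measurable S) (u : ℝ) (hu : 0 ≤ u) (hu1 : 0 < μ {ω | u < S ω}) :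
    ∃ q ∈ Ico (0:ℝ) 1, tailSet μ S q =ᵐ[μ] {ω | u < S ω} := by
  have hm : ∀ u, MeasurableSet {ω | S ω ≤ u} := fun u => measurableSet_le hS measurable_const
  have hcompl : {ω | u < S ω} = {ω | S ω ≤ u}ᶜ := by ext; simp
  have hlt : μ {ω | S ω ≤ u} < 1 := by
    rw [hcompl, prob_compl_eq_one_sub (hm u)] at hu1
    exact tsub_pos_iff_lt.1 hu1
  have hq : ENNReal.ofReal (μ {ω | S ω ≤ u}).toReal = μ {ω | S ω ≤ u} :=
    ENNReal.ofReal_toReal (measure_ne_top _ _)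
  refine ⟨(μ {ω | S ω ≤ u}).toReal, ⟨ENNReal.toReal_nonneg, ?_⟩, ?_⟩
  · exact (ENNReal.toReal_lt_toReal (measure_ne_top _ _) ENNReal.one_ne_top).2 hlt
  set A := {s : ℝ | 0 ≤ s ∧ ENNReal.ofReal (μ {ω | S ω ≤ u}).toReal ≤ μ {ω | S ω ≤ s}} with hA
  have huA : u ∈ A := ⟨hu, hq.le⟩
  have hbdd : BddBelow A := ⟨0, fun s hs => hs.1⟩
  have hle : sInf A ≤ u := csInf_le hbdd huA
  have hsub : {ω | u < S ω} ⊆ tailSet μ S (μ {ω | S ω ≤ u}).toReal :=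
    fun ω (hω : u < S ω) => hle.trans_lt hω
  refine (ae_eq_of_subset_of_measure_ge hsub ?_
    (measurableSet_lt measurable_const hS).nullMeasurableSet (measure_ne_top _ _)).symm
  have hnull : μ (⋃ n : ℕ, {ω | sInf A + 1 / ((n:ℝ) + 1) < S ω} ∩ {ω | S ω ≤ u}) = 0 := by
    rw [measure_iUnion_null_iff]
    intro n
    obtain ⟨s, hs, hs2⟩ := exists_lt_of_csInf_lt ⟨u, huA⟩
      (lt_add_of_pos_right (sInf A) (Nat.one_div_pos_of_nat (α := ℝ) (n := n)))
    have hs3 : μ {ω | S ω ≤ u} ≤ μ {ω | S ω ≤ s} := hq ▸ hs.2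
    by_cases hsu : s ≤ u
    · refine measure_mono_null (t := {ω | S ω ≤ u} \ {ω | S ω ≤ s}) ?_ ?_
      · rintro ω ⟨h1, h2⟩
        exact ⟨h2, not_le.2 (hs2.trans h1)⟩
      · have hss : {ω | S ω ≤ s} ⊆ {ω | S ω ≤ u} := fun ω (h : S ω ≤ s) => h.trans hsu
        rw [measure_sdiff hss (hm s).nullMeasurableSet
          (measure_ne_top _ _)]
        exact tsub_eq_zero_of_le hs3
    · convert measure_empty (μ := μ)
      ext ω
      simp only [mem_inter_iff, mem_ofPred_eq, mem_empty_iff_false, iff_false, not_and, not_le]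
      intro h
      linarith
  have hcov : tailSet μ S (μ {ω | S ω ≤ u}).toReal ⊆ {ω | u < S ω} ∪
      ⋃ n : ℕ, {ω | sInf A + 1 / ((n:ℝ) + 1) < S ω} ∩ {ω | S ω ≤ u} := by
    intro ω hω
    have hω' : sInf A < S ω := hω
    by_cases h : u < S ω
    · exact Or.inl h
    · right
      obtain ⟨n, hn⟩ := exists_nat_one_div_lt (sub_pos.2 hω')
      exact mem_iUnion.2 ⟨n, by simp only [mem_ofPred_eq]; linarith, not_lt.1 h⟩
  calc _ ≤ _ := measure_mono hcov
    _ ≤ _ := measure_union_le _ _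
    _ = _ := by rw [hnull, add_zero]

lemma final_of_nu {Ω : Type*} [MeasurableSpace Ω] (μ : Measure Ω) [IsProbabilityMeasure μ]
    {X S : Ω → ℝ} (hX : Measurable X) (hX0 : ∀ ω, 0 ≤ X ω)
    (hS : Measurable S) (hSi : Integrable S μ) (hS0 : ∀ ω, 0 < S ω) {c : ℝ} (hc : 0 ≤ c)
    (h : nu μ X S = nu μ (fun ω => c * S ω) S) (q : ℝ) (hq : 0 < μ (tailSet μ S q)) :
    cteAlloc μ X S q = c ∧ gteAlloc μ X S q = c := by
  have hm : MeasurableSet (tailSet μ S q) := measurableSet_lt measurable_const hS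
  have tr : ∀ g : ℝ → ℝ, Measurable g →
      ∫ ω, X ω * g (S ω) ∂μ = ∫ ω, c * S ω * g (S ω) ∂μ := by
    intro g hg
    rw [← int_nu μ hX hX0 hS hg, h, int_nu μ (by fun_prop) (fun ω => mul_nonneg hc (hS0 ω).le) hS hg]
  have tr2 : ∀ g : ℝ → ℝ, Measurable g →
      ∫ ω in tailSet μ S q, X ω * g (S ω) ∂μ = ∫ ω in tailSet μ S q, c * S ω * g (S ω) ∂μ := by
    intro g hg
    have := tr ((Ioi (VaR μ S q)).indicator g) (hg.indicator measurableSet_Ioi)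
    rw [← integral_indicator hm, ← integral_indicator hm]
    convert this using 2
    all_goals
      ext ω
      by_cases hω : VaR μ S q < S ω
      · rw [indicator_of_mem (by exact hω), indicator_of_mem (by exact hω)]
      · rw [indicator_of_notMem (by exact hω), indicator_of_notMem (by exact hω), mul_zero]
  constructor
  · have := tr2 (fun _ => 1) measurable_const
    simp only [mul_one, integral_const_mul] at this
    unfold cteAlloc
    rw [this, mul_div_cancel_right₀ _ (set_pos μ hm hq hSi fun ω _ => hS0 ω).ne']
  · have := tr2 (fun x => x⁻¹) measurable_inv
    have e : ∀ ω, c * S ω * (S ω)⁻¹ = c := fun ω => by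
      rw [mul_assoc, mul_inv_cancel₀ (hS0 ω).ne', mul_one]
    simp only [e, ← div_eq_mul_inv] at this
    unfold gteAlloc
    rw [this]
    have hp : (μ (tailSet μ S q)).toReal ≠ 0 :=
      (ENNReal.toReal_pos hq.ne' (measure_ne_top _ _)).ne'
    simp [Measure.real, hp]

/-- Main characterization: the CTE-based and GTE-based proportional allocations agree at all
levels `q ∈ [0,1)` iff all partially size-biased sums have the same Laplace transform; in that
case the common value is `𝔼[X_i]/𝔼[S]`. -/
theorem cteAlloc_eq_gteAlloc_iff_laplace
    {Ω : Type*} [MeasurableSpace Ω] (μ : Measure Ω) [IsProbabilityMeasure μ]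
    (n : ℕ) (X : Fin n → Ω → ℝ)
    (hmeas : ∀ i, Measurable (X i)) (hpos : ∀ i ω, 0 < X i ω)
    (hint : ∀ i, Integrable (X i) μ)
    (S : Ω → ℝ) (hS : S = fun ω => ∑ i, X i ω)
    (hP : ∀ q ∈ Set.Ico (0 : ℝ) 1, 0 < μ (tailSet μ S q)) :
    ((∀ q ∈ Set.Ico (0 : ℝ) 1, ∀ i, cteAlloc μ (X i) S q = gteAlloc μ (X i) S q) ↔
      (∀ i j, i ≠ j → ∀ t : ℝ, 0 < t →
        (∫ ω, X i ω * Real.exp (-t * S ω) ∂μ) / (∫ ω, X i ω ∂μ) =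
          (∫ ω, X j ω * Real.exp (-t * S ω) ∂μ) / (∫ ω, X j ω ∂μ))) ∧
    ((∀ q ∈ Set.Ico (0 : ℝ) 1, ∀ i, cteAlloc μ (X i) S q = gteAlloc μ (X i) S q) →
      ∀ q ∈ Set.Ico (0 : ℝ) 1, ∀ i,
        cteAlloc μ (X i) S q = (∫ ω, X i ω ∂μ) / (∫ ω, S ω ∂μ) ∧
          gteAlloc μ (X i) S q = (∫ ω, X i ω ∂μ) / (∫ ω, S ω ∂μ)) := by
  have hn : Nonempty (Fin n) := by
    by_contra hn
    rw [not_nonempty_iff] at hn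
    have := hP 0 (by simp)
    have h0 : tailSet μ S 0 = ∅ := by
      ext ω
      have := VaR_nonneg μ S 0
      simp only [tailSet, mem_ofPred_eq, mem_empty_iff_false, iff_false, not_lt]
      rw [hS] at this ⊢
      simpa using this
    simp [h0] at this
  have hS0 : ∀ ω, 0 < S ω := fun ω => by
    rw [hS]
    exact Finset.sum_pos (fun i _ => hpos i ω) Finset.univ_nonempty
  have hSm : Measurable S := by
    rw [hS]
    exact Finset.measurable_fun_sum _ fun i _ => hmeas i
  have hSi : Integrable S μ := by
    rw [hS]
    exact integrable_finsetSum _ fun i _ => hint i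
  have hXS : ∀ i ω, X i ω ≤ S ω := fun i ω => by
    rw [hS]
    exact Finset.single_le_sum (f := fun i => X i ω) (fun j _ => (hpos j ω).le) (Finset.mem_univ i)
  have intpos : ∀ f : Ω → ℝ, Integrable f μ → (∀ ω, 0 < f ω) → 0 < ∫ ω, f ω ∂μ := by
    intro f hf h0
    have := set_pos μ (s := univ) MeasurableSet.univ (by simp) hf fun ω _ => h0 ω
    simpa using this
  have hES := intpos S hSi hS0
  have hEX : ∀ i, 0 < ∫ ω, X i ω ∂μ := fun i => intpos _ (hint i) (hpos i)
  have hexp : ∀ t : ℝ, 0 < t → ∀ f : Ω → ℝ, Integrable f μ →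
      Integrable (fun ω => f ω * Real.exp (-t * S ω)) μ := by
    intro t ht f hf
    refine hf.mul_bdd (c := 1) (Measurable.aestronglyMeasurable (by fun_prop))
      (ae_of_all _ fun ω => ?_)
    rw [Real.norm_of_nonneg (Real.exp_pos _).le, Real.exp_le_one_iff]
    nlinarith [hS0 ω]
  set c : Fin n → ℝ := fun i => (∫ ω, X i ω ∂μ) / (∫ ω, S ω ∂μ) with hc
  have hc0 : ∀ i, 0 ≤ c i := fun i => (div_pos (hEX i) hES).le
  have hcS0 : ∀ i ω, 0 ≤ c i * S ω := fun i ω => mul_nonneg (hc0 i) (hS0 ω).le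
  -- the first condition gives the identity of the size-biased laws
  have fwd : (∀ q ∈ Set.Ico (0 : ℝ) 1, ∀ i, cteAlloc μ (X i) S q = gteAlloc μ (X i) S q) →
      ∀ i, nu μ (X i) S = nu μ (fun ω => c i * S ω) S := by
    intro h i
    have hRS : ∀ ω, X i ω / S ω * S ω = X i ω := fun ω => div_mul_cancel₀ _ (hS0 ω).ne'
    have hcore := core μ (R := fun ω => X i ω / S ω) (S := S) ((hmeas i).div hSm)
      (fun ω => by
        rw [abs_of_pos (div_pos (hpos i ω) (hS0 ω)), div_le_one (hS0 ω)]
        exact hXS i ω) hSm hSi hS0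
      (by
        intro u hu hu1
        obtain ⟨q, hq, hqu⟩ := exists_q μ hSm u hu hu1
        have := h q hq i
        unfold cteAlloc gteAlloc at this
        rw [Measure.restrict_congr_set hqu, measure_congr hqu] at this
        simpa only [hRS] using this)
    simp only [hRS] at hcore
    refine ext_tail μ (hmeas i) (fun ω => (hpos i ω).le) (hint i) (by fun_prop) (hcS0 i)
      (hSi.const_mul _) hSm hS0 fun u hu => ?_
    rw [integral_const_mul]
    by_cases h0 : μ {ω | u < S ω} = 0
    · simp [Measure.restrict_eq_zero.2 h0]
    · have hu1 := pos_iff_ne_zero.2 h0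
      rw [← div_eq_iff]
      · exact hcore u hu hu1
      · exact (set_pos μ (measurableSet_lt measurable_const hSm) hu1 hSi fun ω _ => hS0 ω).ne'
  have fin : (∀ i, nu μ (X i) S = nu μ (fun ω => c i * S ω) S) →
      ∀ q ∈ Set.Ico (0 : ℝ) 1, ∀ i, cteAlloc μ (X i) S q = c i ∧ gteAlloc μ (X i) S q = c i :=
    fun h q hq i => final_of_nu μ (hmeas i) (fun ω => (hpos i ω).le) hSm hSi hS0 (hc0 i) (h i) q
      (hP q hq)
  refine ⟨⟨fun h i j _ t ht => ?_, fun h => ?_⟩, fun h => fin (fwd h)⟩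
  · have key : ∀ i, (∫ ω, X i ω * Real.exp (-t * S ω) ∂μ) / (∫ ω, X i ω ∂μ) =
        (∫ ω, S ω * Real.exp (-t * S ω) ∂μ) / ∫ ω, S ω ∂μ := by
      intro i
      have hg : Measurable fun x : ℝ => Real.exp (-t * x) := by fun_prop
      have e : ∫ ω, X i ω * Real.exp (-t * S ω) ∂μ
          = ∫ ω, c i * S ω * Real.exp (-t * S ω) ∂μ := by
        rw [← int_nu μ (hmeas i) (fun ω => (hpos i ω).le) hSm hg, fwd h i,
          int_nu μ (by fun_prop) (hcS0 i) hSm hg]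
      simp only [mul_assoc, integral_const_mul] at e
      rw [e]
      generalize ∫ ω, S ω * Real.exp (-t * S ω) ∂μ = J
      simp only [hc]
      have := (hEX i).ne'
      have := hES.ne'
      field_simp
    rw [key i, key j]
  · have hnu : ∀ i, nu μ (X i) S = nu μ (fun ω => c i * S ω) S := by
      intro i
      refine ext_laplace μ (hmeas i) (fun ω => (hpos i ω).le) (hint i) (by fun_prop) (hcS0 i)
        (hSi.const_mul _) hSm hS0 ?_ fun t ht => ?_
      · rw [integral_const_mul]
        exact (div_mul_cancel₀ _ hES.ne').symm
      · have h1 : ∀ j, (∫ ω, X i ω * Real.exp (-t * S ω) ∂μ) * (∫ ω, X j ω ∂μ) =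
            (∫ ω, X i ω ∂μ) * (∫ ω, X j ω * Real.exp (-t * S ω) ∂μ) := by
          intro j
          by_cases hij : i = j
          · rw [hij, mul_comm]
          · have := h i j hij t ht
            rw [div_eq_div_iff (hEX i).ne' (hEX j).ne'] at this
            rw [this, mul_comm]
        have s1 : ∑ j, (∫ ω, X j ω ∂μ) = ∫ ω, S ω ∂μ := by
          rw [hS, integral_finsetSum _ fun i _ => hint i]
        have s2 : ∑ j, (∫ ω, X j ω * Real.exp (-t * S ω) ∂μ)
            = ∫ ω, S ω * Real.exp (-t * S ω) ∂μ := by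
          rw [← integral_finsetSum _ fun i _ => hexp t ht _ (hint i)]
          congr 1
          ext ω
          rw [← Finset.sum_mul]
          congr 1
          rw [hS]
        have h2 := Finset.sum_congr (rfl : (Finset.univ : Finset (Fin n)) = _) fun j _ => h1 j
        rw [← Finset.mul_sum, ← Finset.mul_sum, s1, s2] at h2
        simp only [mul_assoc, integral_const_mul, hc]
        rw [div_mul_eq_mul_div, eq_div_iff hES.ne']
        exact h2
    intro q hq i
    rw [(fin hnu q hq i).1, (fin hnu q hq i).2]
end

section
/- Let γ_1, …, γ_n > 0, β > 1, γ_• := γ_1 + ⋯ + γ_n, and let (X_1, …, X_n) be a random vector with the inverted-Dirichlet density f(x_1,…,x_n) = (1/B(γ_1,…,γ_n,β)) ∏_{j=1}^{n} x_j^{γ_j−1} (1 + Σ_{j=1}^{n} x_j)^{−(γ_• + β)} on (0,∞)^n, where B(γ_1,…,γ_n,β) := (∏_{j=1}^{n} Γ(γ_j))·Γ(β)/Γ(γ_• + β). Then each X_i is integrable, and with S := X_1 + ⋯ + X_n, for every q ∈ [0,1) and every i ∈ {1,…,n}: r_{q,i} = r̃_{q,i} = γ_i/γ_•. -/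
open MeasureTheory Set

/-- Density of the inverted-Dirichlet distribution `ID_n(γ_1,…,γ_n, β)` on `(0,∞)^n`. -/
noncomputable def invDirichletDensity (n : ℕ) (γ : Fin n → ℝ) (β : ℝ) (x : Fin n → ℝ) : ℝ :=
  if ∀ i, 0 < x i then
    (Real.Gamma ((∑ j, γ j) + β) / ((∏ j, Real.Gamma (γ j)) * Real.Gamma β)) *
      (∏ j, (x j) ^ (γ j - 1)) * (1 + ∑ j, x j) ^ (-((∑ j, γ j) + β))
  else 0

noncomputable def gden (a x : ℝ) : ENNReal :=
  if 0 < x then ENNReal.ofReal (x ^ (a - 1) / Real.Gamma a) else 0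

lemma measurable_gden (a : ℝ) : Measurable (gden a) := by
  unfold gden
  refine Measurable.ite measurableSet_Ioi ?_ measurable_const
  fun_prop

lemma gden_lintegral_exp {a : ℝ} (ha : 0 < a) :
    ∫⁻ x, ENNReal.ofReal (Real.exp (-x)) * gden a x = 1 := by
  have h1 : ∀ x, ENNReal.ofReal (Real.exp (-x)) * gden a x =
      (Ioi (0:ℝ)).indicator (fun x => ENNReal.ofReal ((Real.exp (-x) * x ^ (a-1)) / Real.Gamma a)) x := by
    intro x
    by_cases hx : 0 < x
    · rw [indicator_of_mem (by exact hx), gden, if_pos hx, ← ENNReal.ofReal_mul (Real.exp_pos _).le,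
        mul_div_assoc]
    · rw [indicator_of_notMem (by exact hx), gden, if_neg hx, mul_zero]
  simp_rw [h1]
  rw [lintegral_indicator measurableSet_Ioi, ← ofReal_integral_eq_lintegral_ofReal]
  · rw [integral_div, ← Real.Gamma_eq_integral ha, div_self (Real.Gamma_pos_of_pos ha).ne']
    simp
  · exact (Real.GammaIntegral_convergent ha).div_const _
  · filter_upwards [ae_restrict_mem measurableSet_Ioi] with x hx
    have : (0:ℝ) < x := hx
    have := Real.Gamma_pos_of_pos ha
    positivity

lemma lintegral_scale {s : ℝ} (hs : 0 < s) (f : ℝ → ENNReal) :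
    ∫⁻ x, f x = ENNReal.ofReal s * ∫⁻ u, f (s * u) := by
  have h := Real.smul_map_volume_mul_left hs.ne'
  rw [abs_of_pos hs] at h
  calc ∫⁻ x, f x = ∫⁻ x, f x ∂(ENNReal.ofReal s • Measure.map (s * ·) volume) := by rw [h]
    _ = _ := by
      rw [lintegral_smul_measure]
      have := (Homeomorph.mulLeft₀ s hs.ne').measurableEmbedding.lintegral_map (μ := volume) f
      simp only [Homeomorph.coe_mulLeft₀] at this
      rw [this]; rfl

lemma gden_conv_aux {a b : ℝ} (ha : 0 < a) (hb : 0 < b) (s : ℝ) :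
    ∫⁻ x, gden b (s - x) * gden a x =
      (ENNReal.ofReal (Real.Gamma (a+b)) * ∫⁻ u, gden b (1 - u) * gden a u) * gden (a + b) s := by
  have hGa := Real.Gamma_pos_of_pos ha
  have hGb := Real.Gamma_pos_of_pos hb
  have hG := Real.Gamma_pos_of_pos (add_pos ha hb)
  by_cases hs : 0 < s
  · rw [lintegral_scale hs]
    have h1 : ∀ u, gden b (s - s * u) * gden a (s * u) =
        ENNReal.ofReal (s ^ (a + b - 2)) * (gden b (1 - u) * gden a u) := by
      intro u
      have e : s - s * u = s * (1 - u) := by ring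
      rw [e]
      unfold gden
      simp only [mul_pos_iff_of_pos_left hs]
      split_ifs with h1 h2 <;> try simp only [mul_zero, zero_mul]
      rw [← ENNReal.ofReal_mul (by positivity), ← ENNReal.ofReal_mul (by positivity),
        ← ENNReal.ofReal_mul (by positivity)]
      congr 1
      rw [Real.mul_rpow hs.le h1.le, Real.mul_rpow hs.le h2.le,
        show a + b - 2 = (b - 1) + (a - 1) by ring, Real.rpow_add hs]
      ring
    simp_rw [h1]
    rw [lintegral_const_mul' _ _ ENNReal.ofReal_ne_top, ← mul_assoc, ← ENNReal.ofReal_mul hs.le,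
      mul_right_comm, gden, if_pos hs, ← ENNReal.ofReal_mul hG.le]
    congr 2
    rw [show a + b - 1 = 1 + (a + b - 2) by ring, Real.rpow_add hs, Real.rpow_one]
    field_simp
  · rw [gden, if_neg hs, mul_zero]
    rw [lintegral_eq_zero_of_ae_eq_zero]
    refine Filter.Eventually.of_forall fun x => ?_
    simp only [gden, Pi.zero_apply]
    split_ifs with h1 h2 <;> simp
    exfalso; linarith

lemma gden_conv_aux2 {a b : ℝ} (ha : 0 < a) (hb : 0 < b) {F : ℝ → ENNReal} (hF : Measurable F) :
    ∫⁻ x, ∫⁻ y, F (x + y) * gden b y * gden a x =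
      (ENNReal.ofReal (Real.Gamma (a+b)) * ∫⁻ u, gden b (1 - u) * gden a u) *
        ∫⁻ s, F s * gden (a + b) s := by
  have ma := measurable_gden a
  have mb := measurable_gden b
  have mab := measurable_gden (a + b)
  have h1 : ∀ x, ∫⁻ y, F (x + y) * gden b y * gden a x =
      ∫⁻ s, F s * (gden b (s - x) * gden a x) := by
    intro x
    rw [← lintegral_add_left_eq_self (fun s => F s * (gden b (s - x) * gden a x)) x]
    simp [mul_assoc]
  simp_rw [h1]
  rw [lintegral_lintegral_swap (by fun_prop)]
  have h2 : ∀ s, ∫⁻ x, F s * (gden b (s - x) * gden a x) =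
      (ENNReal.ofReal (Real.Gamma (a+b)) * ∫⁻ u, gden b (1 - u) * gden a u) *
        (F s * gden (a + b) s) := by
    intro s
    rw [lintegral_const_mul _ (by fun_prop), gden_conv_aux ha hb]
    ring
  simp_rw [h2]
  rw [lintegral_const_mul _ (by fun_prop)]

lemma gden_conv {a b : ℝ} (ha : 0 < a) (hb : 0 < b) {F : ℝ → ENNReal} (hF : Measurable F) :
    ∫⁻ x, ∫⁻ y, F (x + y) * gden b y * gden a x = ∫⁻ s, F s * gden (a + b) s := by
  have ma := measurable_gden a
  have mb := measurable_gden b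
  have key := gden_conv_aux2 ha hb (F := fun s => ENNReal.ofReal (Real.exp (-s))) (by fun_prop)
  rw [gden_lintegral_exp (add_pos ha hb), mul_one] at key
  have h1 : ∀ x y, ENNReal.ofReal (Real.exp (-(x + y))) * gden b y * gden a x =
      (ENNReal.ofReal (Real.exp (-x)) * gden a x) * (ENNReal.ofReal (Real.exp (-y)) * gden b y) := by
    intro x y
    rw [neg_add, Real.exp_add, ENNReal.ofReal_mul (Real.exp_pos _).le]
    ring
  simp_rw [h1] at key
  have h2 : ∀ x, ∫⁻ y, (ENNReal.ofReal (Real.exp (-x)) * gden a x) *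
      (ENNReal.ofReal (Real.exp (-y)) * gden b y) = ENNReal.ofReal (Real.exp (-x)) * gden a x := by
    intro x
    rw [lintegral_const_mul _ (by fun_prop), gden_lintegral_exp hb, mul_one]
  simp_rw [h2] at key
  rw [gden_lintegral_exp ha] at key
  rw [gden_conv_aux2 ha hb hF, ← key, one_mul]

lemma lintegral_fin_succ {n : ℕ} {F : (Fin (n+1) → ℝ) → ENNReal} (hF : Measurable F) :
    ∫⁻ x, F x = ∫⁻ y : ℝ, ∫⁻ x : Fin n → ℝ, F (Fin.cons y x) := by
  have h := (volume_preserving_piFinSuccAbove (fun _ : Fin (n+1) => ℝ) 0).symm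
  rw [← h.lintegral_comp hF, Measure.volume_eq_prod, lintegral_prod]
  · refine lintegral_congr fun y => lintegral_congr fun x => ?_
    simp [MeasurableEquiv.piFinSuccAbove]
    rfl
  · exact (hF.comp (MeasurableEquiv.measurable _)).aemeasurable

lemma gden_pi_aux (n : ℕ) : ∀ (a : Fin n → ℝ), (∀ i, 0 < a i) → ∀ {b : ℝ}, 0 < b →
    ∀ {F : ℝ → ENNReal}, Measurable F →
    ∫⁻ y : ℝ, (∫⁻ x : Fin n → ℝ, F (y + ∑ j, x j) * ∏ j, gden (a j) (x j)) * gden b y =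
      ∫⁻ s, F s * gden (b + ∑ j, a j) s := by
  induction n with
  | zero =>
    intro a ha b hb F hF
    simp [lintegral_unique, volume_pi]
  | succ n ih =>
    intro a ha b hb F hF
    have mg := fun i => measurable_gden (a i)
    have hm : ∀ y : ℝ, Measurable fun x : Fin (n+1) → ℝ =>
        F (y + ∑ j, x j) * ∏ j, gden (a j) (x j) := by
      intro y; fun_prop
    simp_rw [lintegral_fin_succ (hm _)]
    simp only [Fin.sum_univ_succ, Fin.prod_univ_succ, Fin.cons_zero, Fin.cons_succ]
    set H : ℝ → ENNReal := fun z =>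
      ∫⁻ x : Fin n → ℝ, F (z + ∑ j, x j) * ∏ j, gden (a j.succ) (x j) with hH
    have mH : Measurable H := by
      apply Measurable.lintegral_prod_right' (f := fun p : ℝ × (Fin n → ℝ) =>
        F (p.1 + ∑ j, p.2 j) * ∏ j, gden (a j.succ) (p.2 j))
      fun_prop
    rw [← add_assoc, ← ih (fun j => a j.succ) (fun j => ha _) (add_pos hb (ha 0)) hF]
    change _ = ∫⁻ y, H y * gden (b + a 0) y
    rw [← gden_conv hb (ha 0) mH]
    refine lintegral_congr fun y => ?_
    rw [← lintegral_mul_const _ ?_]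
    · refine lintegral_congr fun z => ?_
      congr 1
      rw [hH]
      simp only
      rw [← lintegral_mul_const _ (by fun_prop)]
      refine lintegral_congr fun x => ?_
      rw [add_assoc]; ring
    · apply Measurable.lintegral_prod_right' (f := fun p : ℝ × (Fin n → ℝ) =>
        F (y + (p.1 + ∑ j, p.2 j)) * (gden (a 0) p.1 * ∏ j, gden (a j.succ) (p.2 j)))
      fun_prop

lemma gden_pi {n : ℕ} (a : Fin n → ℝ) (ha : ∀ i, 0 < a i) (i : Fin n)
    {F : ℝ → ENNReal} (hF : Measurable F) :
    ∫⁻ x : Fin n → ℝ, F (∑ j, x j) * ∏ j, gden (a j) (x j) =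
      ∫⁻ s, F s * gden (∑ j, a j) s := by
  cases n with
  | zero => exact i.elim0
  | succ n =>
    have mg := fun i => measurable_gden (a i)
    rw [lintegral_fin_succ (by fun_prop), Fin.sum_univ_succ,
      ← gden_pi_aux n (fun j => a j.succ) (fun j => ha _) (ha 0) hF]
    refine lintegral_congr fun y => ?_
    rw [← lintegral_mul_const _ (by fun_prop)]
    refine lintegral_congr fun x => ?_
    simp only [Fin.sum_univ_succ, Fin.prod_univ_succ, Fin.cons_zero, Fin.cons_succ]
    ring

noncomputable def phiD (p s : ℝ) : ENNReal := ENNReal.ofReal ((1 + s) ^ (-p))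

lemma measurable_phiD (p : ℝ) : Measurable (phiD p) := by
  unfold phiD; fun_prop

lemma dens_eq {n : ℕ} {γ : Fin n → ℝ} {β : ℝ} (hγ : ∀ i, 0 < γ i) (hβ : 0 < β) (x : Fin n → ℝ) :
    ENNReal.ofReal (invDirichletDensity n γ β x) =
      ENNReal.ofReal (Real.Gamma ((∑ j, γ j) + β) / Real.Gamma β) *
        (phiD ((∑ j, γ j) + β) (∑ j, x j) * ∏ j, gden (γ j) (x j)) := by
  unfold invDirichletDensity
  split_ifs with h
  · have hG : ∀ j, 0 < Real.Gamma (γ j) := fun j => Real.Gamma_pos_of_pos (hγ j)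
    have hGb := Real.Gamma_pos_of_pos hβ
    have hs : 0 ≤ ∑ j, γ j := Finset.sum_nonneg fun j _ => (hγ j).le
    have hGs : 0 < Real.Gamma ((∑ j, γ j) + β) := Real.Gamma_pos_of_pos (by linarith)
    have hx : 0 ≤ ∑ j, x j := Finset.sum_nonneg fun j _ => (h j).le
    have h1 : ∏ j, gden (γ j) (x j) =
        ENNReal.ofReal ((∏ j, (x j) ^ (γ j - 1)) / ∏ j, Real.Gamma (γ j)) := by
      rw [← Finset.prod_div_distrib, ENNReal.ofReal_prod_of_nonneg]
      · exact Finset.prod_congr rfl fun j _ => by rw [gden, if_pos (h j)]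
      · intro j _
        have := h j
        have := hG j
        positivity
    rw [h1, phiD, ← ENNReal.ofReal_mul (by positivity), ← ENNReal.ofReal_mul (by positivity)]
    congr 1
    have : 0 < ∏ j, Real.Gamma (γ j) := Finset.prod_pos fun j _ => hG j
    field_simp
  · push Not at h
    obtain ⟨i, hi⟩ := h
    rw [Finset.prod_eq_zero (Finset.mem_univ i)]
    · simp
    · rw [gden, if_neg hi.not_gt]

lemma mul_gden {a : ℝ} (ha : 0 < a) (x : ℝ) :
    ENNReal.ofReal x * gden a x = ENNReal.ofReal a * gden (a + 1) x := by
  unfold gden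
  split_ifs with h
  · rw [← ENNReal.ofReal_mul h.le, ← ENNReal.ofReal_mul ha.le, Real.Gamma_add_one ha.ne']
    congr 1
    have := Real.Gamma_pos_of_pos ha
    rw [show a + 1 - 1 = 1 + (a - 1) by ring, Real.rpow_add h, Real.rpow_one]
    field_simp
  · simp

lemma mul_prod_gden {n : ℕ} {γ : Fin n → ℝ} (hγ : ∀ i, 0 < γ i) (i : Fin n) (x : Fin n → ℝ) :
    ENNReal.ofReal (x i) * ∏ j, gden (γ j) (x j) =
      ENNReal.ofReal (γ i) * ∏ j, gden (γ j + if j = i then 1 else 0) (x j) := by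
  rw [← Finset.mul_prod_erase _ _ (Finset.mem_univ i), ← mul_assoc, mul_gden (hγ i),
    ← Finset.mul_prod_erase _ _ (Finset.mem_univ i), if_pos rfl, mul_assoc]
  congr 2
  refine Finset.prod_congr rfl fun j hj => ?_
  rw [if_neg (Finset.ne_of_mem_erase hj), add_zero]

lemma phi_pos {a p : ℝ} (ha : 0 < a) (s : ℝ) (h : ℝ → ENNReal) (hh : Measurable h)
    (hpos : ∀ t, s < t → 0 < t → h t ≠ 0) :
    0 < ∫⁻ t, (h t * phiD p t) * gden a t := by
  have m1 := measurable_phiD p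
  have m2 := measurable_gden a
  rw [lintegral_pos_iff_support (by fun_prop)]
  refine lt_of_lt_of_le ?_ (measure_mono (s := Ioi (max s 0)) ?_)
  · simp
  · intro t ht
    have ht' : s < t ∧ 0 < t := by simpa using ht
    have := Real.Gamma_pos_of_pos ha
    have h0 := ht'.2
    rw [Function.mem_support]
    refine mul_ne_zero (mul_ne_zero (hpos t ht'.1 ht'.2) ?_) ?_
    · rw [phiD]
      have : 0 < (1 + t) ^ (-p) := by positivity
      simpa using this
    · rw [gden, if_pos h0]
      have : 0 < t ^ (a - 1) / Real.Gamma a := by positivity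
      simpa using this

lemma phi_fin {c β : ℝ} (hc : 0 < c) (hβ : 1 < β) :
    ∫⁻ t, (1 * phiD (c + β) t) * gden (c + 1) t < ⊤ := by
  have hG := Real.Gamma_pos_of_pos (show 0 < c + 1 by linarith)
  have hi : Integrable (fun t : ℝ => (1 + ‖t‖) ^ (-β) / Real.Gamma (c + 1)) :=
    (integrable_one_add_norm (by simpa using hβ)).div_const _
  refine lt_of_le_of_lt (lintegral_mono fun t => ?_) hi.lintegral_lt_top
  unfold gden phiD
  split_ifs with ht
  · rw [one_mul, ← ENNReal.ofReal_mul (by positivity)]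
    apply ENNReal.ofReal_le_ofReal
    rw [← mul_div_assoc]
    gcongr
    rw [Real.norm_of_nonneg ht.le, neg_add, Real.rpow_add (by linarith), mul_right_comm,
      add_sub_cancel_right]
    have h1 : t ^ c ≤ (1 + t) ^ c := by gcongr; linarith
    have h2 : (1 + t) ^ (-c) * (1 + t) ^ c = 1 := by
      rw [← Real.rpow_add (by linarith)]; simp
    calc (1 + t) ^ (-c) * t ^ c * (1 + t) ^ (-β) ≤
        (1 + t) ^ (-c) * (1 + t) ^ c * (1 + t) ^ (-β) := by gcongr
      _ = _ := by rw [h2, one_mul]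
  · simp

theorem invertedDirichlet_mem_W
    {Ω : Type*} [MeasurableSpace Ω] (μ : Measure Ω) [IsProbabilityMeasure μ]
    (n : ℕ) (X : Fin n → Ω → ℝ) (hmeas : ∀ i, Measurable (X i))
    (γ : Fin n → ℝ) (β : ℝ) (hγ : ∀ i, 0 < γ i) (hβ : 1 < β)
    (hlaw : Measure.map (fun ω => fun i => X i ω) μ =
      (volume : Measure (Fin n → ℝ)).withDensity
        (fun x => ENNReal.ofReal (invDirichletDensity n γ β x)))
    (S : Ω → ℝ) (hS : S = fun ω => ∑ i, X i ω) :
    (∀ i, Integrable (X i) μ) ∧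
      ∀ q ∈ Set.Ico (0 : ℝ) 1, ∀ i,
        cteAlloc μ (X i) S q = gteAlloc μ (X i) S q ∧
          cteAlloc μ (X i) S q = γ i / (∑ j, γ j) := by
  have hβ0 : 0 < β := by linarith
  have mg := fun a => measurable_gden a
  have mphi := fun a => measurable_phiD a
  have mS : Measurable S := by rw [hS]; fun_prop
  have hGb := Real.Gamma_pos_of_pos hβ0
  set g : ℝ := ∑ j, γ j with hg
  have hg0 : 0 ≤ g := Finset.sum_nonneg fun j _ => (hγ j).le
  have hGs : 0 < Real.Gamma (g + β) := Real.Gamma_pos_of_pos (by linarith)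
  set c : ENNReal := ENNReal.ofReal (Real.Gamma (g + β) / Real.Gamma β) with hc
  have hc0 : c ≠ 0 := by
    have : 0 < Real.Gamma (g + β) / Real.Gamma β := by positivity
    rw [hc]; simpa using this
  have hdens : (fun x => ENNReal.ofReal (invDirichletDensity n γ β x)) =
      fun x => c * (phiD (g + β) (∑ j, x j) * ∏ j, gden (γ j) (x j)) :=
    funext fun x => dens_eq hγ hβ0 x
  have mdens : Measurable (fun x => ENNReal.ofReal (invDirichletDensity n γ β x)) := by
    rw [hdens]; fun_prop
  have mX : Measurable (fun ω => fun i => X i ω) := measurable_pi_lambda _ hmeas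
  -- transfer
  have trans : ∀ f : (Fin n → ℝ) → ENNReal, Measurable f →
      ∫⁻ ω, f (fun i => X i ω) ∂μ =
        c * ∫⁻ x, (phiD (g + β) (∑ j, x j) * ∏ j, gden (γ j) (x j)) * f x := by
    intro f hf
    rw [← lintegral_map hf mX, hlaw, lintegral_withDensity_eq_lintegral_mul _ mdens hf, hdens,
      ← lintegral_const_mul _ (by fun_prop)]
    refine lintegral_congr fun x => ?_
    simp only [Pi.mul_apply, mul_assoc]
  have key : ∀ h : ℝ → ENNReal, Measurable h → ∀ i,
      ∫⁻ ω, ENNReal.ofReal (X i ω) * h (S ω) ∂μ =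
        ENNReal.ofReal (γ i) * (c * ∫⁻ t, (h t * phiD (g + β) t) * gden (g + 1) t) := by
    intro h hh i
    have e := trans (fun x => ENNReal.ofReal (x i) * h (∑ j, x j)) (by fun_prop)
    rw [hS]
    refine e.trans ?_
    have e2 := gden_pi (fun j => γ j + if j = i then 1 else 0)
      (fun j => by have := hγ j; split_ifs <;> linarith) i
      (F := fun t => h t * phiD (g + β) t) (by fun_prop)
    have e3 : ∑ j, (γ j + if j = i then (1:ℝ) else 0) = g + 1 := by
      rw [Finset.sum_add_distrib]; simp [hg]
    rw [e3] at e2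
    rw [← e2, mul_left_comm]
    congr 1
    rw [← lintegral_const_mul _ (by fun_prop)]
    refine lintegral_congr fun x => ?_
    have := mul_prod_gden hγ i x
    calc _ = phiD (g + β) (∑ j, x j) * h (∑ j, x j) *
          (ENNReal.ofReal (x i) * ∏ j, gden (γ j) (x j)) := by ring
      _ = _ := by rw [this]; ring
  have hXpos : ∀ᵐ ω ∂μ, ∀ i, 0 < X i ω := by
    have h1 : ∀ᵐ x ∂(Measure.map (fun ω => fun i => X i ω) μ), ∀ i, 0 < x i := by
      rw [hlaw, ae_withDensity_iff mdens]
      refine Filter.Eventually.of_forall fun x hx => ?_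
      by_contra hn
      exact hx (by simp [invDirichletDensity, hn])
    exact ae_of_ae_map mX.aemeasurable h1
  have hgpos : ∀ i : Fin n, 0 < g := fun i =>
    Finset.sum_pos (fun j _ => hγ j) ⟨i, Finset.mem_univ i⟩
  have hint : ∀ i, Integrable (X i) μ := by
    intro i
    have h1 := key (fun _ => 1) measurable_const i
    simp only [mul_one] at h1
    refine (lintegral_ofReal_ne_top_iff_integrable (hmeas i).aestronglyMeasurable ?_).1 ?_
    · filter_upwards [hXpos] with ω hω using (hω i).le
    · rw [h1]
      exact ENNReal.mul_ne_top ENNReal.ofReal_ne_top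
        (ENNReal.mul_ne_top ENNReal.ofReal_ne_top (phi_fin (hgpos i) hβ).ne)
  refine ⟨hint, fun q _ i => ?_⟩
  have hgi := hgpos i
  set s := VaR μ S q with hs
  have hT : tailSet μ S q = S ⁻¹' (Ioi s) := rfl
  have mT : MeasurableSet (S ⁻¹' (Ioi s)) := mS measurableSet_Ioi
  have hSpos : ∀ᵐ ω ∂μ, 0 < S ω := by
    filter_upwards [hXpos] with ω hω
    rw [hS]
    exact Finset.sum_pos (fun j _ => hω j) ⟨i, Finset.mem_univ i⟩
  -- weighted tails
  have gen : ∀ w : ℝ → ℝ, Measurable w → (∀ t, 0 < t → 0 < w t) →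
      ∃ k : ℝ, (∀ j, ∫ ω in S ⁻¹' (Ioi s), X j ω * w (S ω) ∂μ = γ j * k) ∧
        ∫ ω in S ⁻¹' (Ioi s), S ω * w (S ω) ∂μ = g * k ∧
        ((∫⁻ ω in S ⁻¹' (Ioi s), ENNReal.ofReal (S ω * w (S ω)) ∂μ) ≠ ⊤ → k ≠ 0) := by
    intro w mw hw
    set h : ℝ → ENNReal := (Ioi s).indicator (fun t => ENNReal.ofReal (w t)) with hh
    have mh : Measurable h := (mw.ennreal_ofReal).indicator measurableSet_Ioi
    set K : ENNReal := c * ∫⁻ t, (h t * phiD (g + β) t) * gden (g + 1) t with hK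
    have hK0 : K ≠ 0 := by
      refine mul_ne_zero hc0 (phi_pos (by linarith) s h mh ?_).ne'
      intro t h1 h2
      rw [hh, indicator_of_mem (by exact h1)]
      simpa using hw t h2
    have hj : ∀ j, ∫⁻ ω in S ⁻¹' (Ioi s), ENNReal.ofReal (X j ω * w (S ω)) ∂μ =
        ENNReal.ofReal (γ j) * K := by
      intro j
      rw [hK, ← key h mh j, ← lintegral_indicator mT]
      refine lintegral_congr_ae ?_
      filter_upwards [hXpos] with ω hω
      by_cases hm : S ω ∈ Ioi s
      · rw [indicator_of_mem (by exact hm), hh, indicator_of_mem hm, ENNReal.ofReal_mul (hω j).le]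
      · rw [indicator_of_notMem (by exact hm), hh, indicator_of_notMem hm, mul_zero]
    have hsum : ∫⁻ ω in S ⁻¹' (Ioi s), ENNReal.ofReal (S ω * w (S ω)) ∂μ =
        ENNReal.ofReal g * K := by
      have : ∫⁻ ω in S ⁻¹' (Ioi s), ENNReal.ofReal (S ω * w (S ω)) ∂μ =
          ∫⁻ ω in S ⁻¹' (Ioi s), ∑ j, ENNReal.ofReal (X j ω * w (S ω)) ∂μ := by
        refine lintegral_congr_ae (ae_restrict_of_ae ?_)
        filter_upwards [hXpos, hSpos] with ω h1 h2
        rw [← ENNReal.ofReal_sum_of_nonneg, ← Finset.sum_mul]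
        · congr 2
          rw [hS]
        · intro j _
          exact mul_nonneg (h1 j).le (hw _ h2).le
      rw [this, lintegral_finsetSum _ (fun j _ => by fun_prop)]
      simp_rw [hj]
      rw [← Finset.sum_mul, ← ENNReal.ofReal_sum_of_nonneg fun j _ => (hγ j).le]
    refine ⟨K.toReal, fun j => ?_, ?_, fun hfin => ?_⟩
    · rw [integral_eq_lintegral_of_nonneg_ae, hj, ENNReal.toReal_mul,
        ENNReal.toReal_ofReal (hγ j).le]
      · refine ae_restrict_of_ae ?_
        filter_upwards [hXpos, hSpos] with ω h1 h2
        exact mul_nonneg (h1 j).le (hw _ h2).le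
      · exact Measurable.aestronglyMeasurable (by fun_prop)
    · rw [integral_eq_lintegral_of_nonneg_ae, hsum, ENNReal.toReal_mul,
        ENNReal.toReal_ofReal hg0]
      · refine ae_restrict_of_ae ?_
        filter_upwards [hXpos, hSpos] with ω h1 h2
        exact mul_nonneg h2.le (hw _ h2).le
      · exact Measurable.aestronglyMeasurable (by fun_prop)
    · rw [hsum] at hfin
      refine ENNReal.toReal_ne_zero.2 ⟨hK0, fun hKt => hfin ?_⟩
      rw [hKt]
      exact ENNReal.mul_top (by simpa using hgi)
  have hSint : Integrable S μ := by
    rw [hS]; exact integrable_finsetSum _ fun j _ => hint j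
  obtain ⟨k1, a1, b1, c1⟩ := gen (fun _ => 1) measurable_const (fun _ _ => one_pos)
  obtain ⟨k2, a2, b2, c2⟩ := gen (fun t => t⁻¹) measurable_inv (fun t ht => inv_pos.2 ht)
  simp only [mul_one] at a1 b1 c1
  have hk1 : k1 ≠ 0 := c1 hSint.integrableOn.lintegral_lt_top.ne
  have hone : ∀ᵐ ω ∂(μ.restrict (S ⁻¹' (Ioi s))), S ω * (S ω)⁻¹ = 1 := by
    refine ae_restrict_of_ae ?_
    filter_upwards [hSpos] with ω h2 using mul_inv_cancel₀ h2.ne'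
  have hk2 : k2 ≠ 0 := by
    apply c2
    rw [lintegral_congr_ae (hone.mono fun ω h => by rw [h])]
    simp
  have hcte : cteAlloc μ (X i) S q = γ i / g := by
    rw [cteAlloc, hT, a1, b1]
    field_simp
  have hgte : gteAlloc μ (X i) S q = γ i / g := by
    have e : (μ (S ⁻¹' (Ioi s))).toReal = g * k2 := by
      rw [← b2, integral_congr_ae hone]
      simp [Measure.real]
    rw [gteAlloc, hT, e]
    simp_rw [div_eq_mul_inv] at a2 ⊢
    rw [a2]
    field_simp
  exact ⟨hcte.trans hgte.symm, hcte⟩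
end
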